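/- Let I = ⟨G, k⟩ be an instance of the Pebbling Number problem, where G = ⟨N,E⟩ is a directed graph and k an integer. Let Π = ∀^st P1 ∃^st P2 : C be the ASP(Q) program in which P1 encodes G and guesses an arbitrary assignment of exactly k pebbles to nodes of G together with an arbitrary target node; P2 guesses a number T ≤ k−1 of steps and a sequence of T valid pebbling moves starting from the guessed assignment (each move along an edge (a,b) requires at least two pebbles on a, removes two pebbles from a, and adds one pebble to b), maintaining the pebble counts on all nodes at each step; and C requires the target node to carry at least one pebble after step T. Then π(G) ≤ k if and only if Π is coherent. -/

import Mathlib

/- ===== Core formalization of propositional ASP and ASP(Q) ===== -/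

namespace ASPQ

/-- A ground disjunctive rule `a₁ ∨ … ∨ a_l ← b₁,…,b_m, not c₁,…, not c_n`
(atoms are natural numbers). -/
structure Rule where
  head : Finset ℕ
  pos : Finset ℕ
  neg : Finset ℕ
deriving DecidableEq

/-- A (ground) disjunctive program: a finite set of rules. -/
abbrev Program := Finset Rule

/-- An interpretation: a finite set of atoms. -/
abbrev Interp := Finset ℕ

def Rule.atoms (r : Rule) : Finset ℕ := r.head ∪ r.pos ∪ r.neg

/-- The Herbrand base (set of atoms) of a program. -/
def atomsOf (P : Program) : Finset ℕ := P.sup Rule.atoms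

/-- `I` is a model of rule `r`. -/
def modelsRule (I : Interp) (r : Rule) : Prop :=
  r.pos ⊆ I → r.neg ∩ I = ∅ → (r.head ∩ I).Nonempty

/-- `I` is a model of program `P`. -/
def models (I : Interp) (P : Program) : Prop := ∀ r ∈ P, modelsRule I r

/-- The Gelfond-Lifschitz reduct `P^I`. -/
def reduct (P : Program) (I : Interp) : Program :=
  (P.filter (fun r => r.neg ∩ I = ∅)).image (fun r => ⟨r.head, r.pos, ∅⟩)

/-- The constraints (rules with empty head) of `P`. -/
def constraintsOf (P : Program) : Program := P.filter (fun r => r.head = ∅)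

/-- The non-constraint rules of `P`. -/
def properOf (P : Program) : Program := P.filter (fun r => r.head ≠ ∅)

/-- `I` is a minimal model of `P`. -/
def minModel (I : Interp) (P : Program) : Prop :=
  models I P ∧ ∀ J : Interp, J ⊂ I → ¬ models J P

/-- `I` is an answer set (stable model) of `P`: an answer set of `P` minus its
constraints that is also a model of the constraints of `P`. -/
def answerSet (P : Program) (I : Interp) : Prop :=
  I ⊆ atomsOf P ∧ minModel I (reduct (properOf P) I) ∧ models I (constraintsOf P)

/-- The set of answer sets of `P`. -/
def AS (P : Program) : Set Interp := {I | answerSet P I}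

/-- A program is coherent if it has an answer set. -/
def coherentP (P : Program) : Prop := (AS P).Nonempty

def factRule (a : ℕ) : Rule := ⟨{a}, ∅, ∅⟩
def constrRule (a : ℕ) : Rule := ⟨∅, {a}, ∅⟩

/-- `fix_P(I)`: the facts `a` for `a ∈ I` and constraints `← a` for `a ∈ B_P ∖ I`. -/
def fixProg (P : Program) (I : Interp) : Program :=
  I.image factRule ∪ (atomsOf P \ I).image constrRule

def normalRule (r : Rule) : Prop := r.head.card ≤ 1

/-- A program is normal if each rule has at most one head atom. -/
def normalProg (P : Program) : Prop := ∀ r ∈ P, normalRule r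

/-- A (ground) program is stratified: there is a level mapping of atoms such that
for each rule, positive body atoms have level at most that of each head atom and
negative body atoms have strictly smaller level. -/
def stratifiedProg (P : Program) : Prop :=
  ∃ ℓ : ℕ → ℕ, ∀ r ∈ P, ∀ a ∈ r.head,
    (∀ b ∈ r.pos, ℓ b ≤ ℓ a) ∧ (∀ c ∈ r.neg, ℓ c < ℓ a)

/-- An ASP(Q) program `□₁ P₁ … □ₙ Pₙ : C`; `true` stands for `∃ˢᵗ`, `false` for `∀ˢᵗ`. -/
structure QProg where
  pre : List (Bool × Program)
  con : Program

/-- Well-formedness of an ASP(Q) program: at least one quantifier, and the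
constraint program `C` is a stratified normal program. -/
def wellFormedQ (Φ : QProg) : Prop :=
  Φ.pre ≠ [] ∧ normalProg Φ.con ∧ stratifiedProg Φ.con

/-- A normal ASP(Q) program: each quantified program is normal. -/
def normalQ (Φ : QProg) : Prop := ∀ p ∈ Φ.pre, normalProg p.2

/-- An existential ASP(Q) program: `□₁ = ∃ˢᵗ`. -/
def existentialQ (Φ : QProg) : Prop := ∃ P rest, Φ.pre = (true, P) :: rest

/-- A universal ASP(Q) program: `□₁ = ∀ˢᵗ`. -/
def universalQ (Φ : QProg) : Prop := ∃ P rest, Φ.pre = (false, P) :: rest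

/-- Coherence of the remainder of an ASP(Q) program, where `F` is the `fix`
program contributed by the answer set chosen at the previous level
(`F = ∅` initially): `cohFrom C F [(□₁,P₁),…,(□ₙ,Pₙ)]` means that
`□₁ (P₁ ∪ F) □₂ P₂ … □ₙ Pₙ : C` is coherent. -/
def cohFrom (C : Program) : Program → List (Bool × Program) → Prop
  | F, [] => coherentP (C ∪ F)
  | F, (q, P) :: rest =>
      if q then ∃ M ∈ AS (P ∪ F), cohFrom C (fixProg (P ∪ F) M) rest
      else ∀ M ∈ AS (P ∪ F), cohFrom C (fixProg (P ∪ F) M) rest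

/-- Coherence of an ASP(Q) program. -/
def QProg.coherent (Φ : QProg) : Prop := cohFrom Φ.con ∅ Φ.pre

/-- The quantified answer sets of an (existential) ASP(Q) program. -/
def QProg.QAS (Φ : QProg) : Set Interp :=
  match Φ.pre with
  | [] => ∅
  | (q, P1) :: rest => {M | q = true ∧ M ∈ AS P1 ∧ cohFrom Φ.con (fixProg P1 M) rest}

end ASPQ

namespace ASPQ

open scoped Classical

/-- The effect of a pebbling move along `(a,b)`: remove two pebbles from `a`,
add one pebble to `b`. -/
noncomputable def pebMove {V : Type} [DecidableEq V] (D : V → ℕ) (a b : V) : V → ℕ :=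
  Function.update (Function.update D a (D a - 2)) b (Function.update D a (D a - 2) b + 1)

/-- The result of applying a sequence of pebbling moves from the pebble
distribution `D` (`none` if some move is invalid: a move along `(a,b)` requires
`(a,b)` to be an edge and at least two pebbles on `a`). -/
noncomputable def moveSeqResult {V : Type} [DecidableEq V] (E : V → V → Prop) :
    (V → ℕ) → List (V × V) → Option (V → ℕ)
  | D, [] => some D
  | D, m :: rest =>
      if E m.1 m.2 ∧ 2 ≤ D m.1 then moveSeqResult E (pebMove D m.1 m.2) rest else none

/-- The defining condition of the pebbling number at value `k`: for every
assignment of `k` pebbles to the nodes and every target node `w`, some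
(possibly empty) sequence of pebbling moves results in a pebble on `w`. -/
noncomputable def pebCond {V : Type} [Fintype V] [DecidableEq V]
    (E : V → V → Prop) (k : ℕ) : Prop :=
  ∀ D : V → ℕ, (∑ v, D v) = k → ∀ w : V,
    ∃ (ms : List (V × V)) (D' : V → ℕ), moveSeqResult E D ms = some D' ∧ 1 ≤ D' w

/-- The pebbling number `π(G)` of a directed graph `G = ⟨V,E⟩`: the smallest
number `k` (as an extended natural, `⊤` if there is none) such that `pebCond`
holds at `k`. -/
noncomputable def pebblingNumber {V : Type} [Fintype V] [DecidableEq V]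
    (E : V → V → Prop) : ℕ∞ :=
  sInf {n : ℕ∞ | ∃ k : ℕ, n = k ∧ pebCond E k}

theorem sum_pebMove {V : Type} [Fintype V] [DecidableEq V] (D : V → ℕ) (a b : V)
    (h : 2 ≤ D a) : (∑ v, pebMove D a b v) + 1 = ∑ v, D v := by
  unfold pebMove
  rw [Finset.sum_update_of_mem (Finset.mem_univ b)]
  have h₁ := Finset.sum_update_of_mem (Finset.mem_univ a) D (D a - 2)
  have h₂ := Finset.sum_eq_add_sum_sdiff_singleton_of_mem (Finset.mem_univ b)
    (Function.update D a (D a - 2))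
  have h₃ := Finset.sum_eq_add_sum_sdiff_singleton_of_mem (Finset.mem_univ a) D
  omega

theorem pebMove_mono {V : Type} [DecidableEq V] {D₁ D₂ : V → ℕ} (h : D₁ ≤ D₂) (a b : V) :
    pebMove D₁ a b ≤ pebMove D₂ a b := by
  intro v
  have ha : D₁ a ≤ D₂ a := h a
  have hb : D₁ b ≤ D₂ b := h b
  have hv : D₁ v ≤ D₂ v := h v
  simp only [pebMove, Function.update_apply]
  split_ifs <;> omega

theorem sum_moveSeqResult {V : Type} [Fintype V] [DecidableEq V] {E : V → V → Prop}
    {ms : List (V × V)} {D D' : V → ℕ} (h : moveSeqResult E D ms = some D') :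
    (∑ v, D' v) + ms.length = ∑ v, D v := by
  induction ms generalizing D with
  | nil =>
    simp only [moveSeqResult, Option.some.injEq] at h
    simp [h]
  | cons m ms ih =>
    simp only [moveSeqResult] at h
    split_ifs at h with hm
    have h₁ := ih h
    have h₂ := sum_pebMove D m.1 m.2 hm.2
    simp only [List.length_cons]
    omega

theorem moveSeqResult_mono {V : Type} [DecidableEq V] {E : V → V → Prop}
    {ms : List (V × V)} {D₁ D₂ D₁' : V → ℕ} (hD : D₁ ≤ D₂)
    (h : moveSeqResult E D₁ ms = some D₁') :
    ∃ D₂', moveSeqResult E D₂ ms = some D₂' ∧ D₁' ≤ D₂' := by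
  induction ms generalizing D₁ D₂ with
  | nil =>
    simp only [moveSeqResult, Option.some.injEq] at h
    exact ⟨D₂, rfl, h ▸ hD⟩
  | cons m ms ih =>
    simp only [moveSeqResult] at h ⊢
    split_ifs at h with hm
    rw [if_pos ⟨hm.1, hm.2.trans (hD m.1)⟩]
    exact ih (pebMove_mono hD m.1 m.2) h

theorem exists_le_sum_eq {V : Type} [Fintype V] (D : V → ℕ) {j : ℕ} (hj : j ≤ ∑ v, D v) :
    ∃ D₀ ≤ D, ∑ v, D₀ v = j := by
  classical
  induction hj using Nat.decreasingInduction with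
  | self => exact ⟨D, le_rfl, rfl⟩
  | of_succ i _ ih =>
    obtain ⟨D₀, hD₀, hsum⟩ := ih
    obtain ⟨a, -, ha⟩ : ∃ a ∈ Finset.univ, D₀ a ≠ 0 :=
      Finset.exists_ne_zero_of_sum_ne_zero (by omega)
    refine ⟨Function.update D₀ a (D₀ a - 1), fun v => ?_, ?_⟩
    · have hv : D₀ v ≤ D v := hD₀ v
      rw [Function.update_apply]
      split_ifs with hva
      · exact hva ▸ (Nat.sub_le _ _).trans hv
      · exact hv
    · rw [Finset.sum_update_of_mem (Finset.mem_univ a)]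
      have h₁ := Finset.sum_eq_add_sum_sdiff_singleton_of_mem (Finset.mem_univ a) D₀
      omega

theorem pebCond_mono {V : Type} [Fintype V] [DecidableEq V] {E : V → V → Prop} {j k : ℕ}
    (hjk : j ≤ k) (h : pebCond E j) : pebCond E k := by
  intro D hD w
  obtain ⟨D₀, hD₀, hsum⟩ := exists_le_sum_eq D (hjk.trans_eq hD.symm)
  obtain ⟨ms, D', hms, hw⟩ := h D₀ hsum w
  obtain ⟨D'', hms', hle⟩ := moveSeqResult_mono hD₀ hms
  exact ⟨ms, D'', hms', hw.trans (hle w)⟩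

theorem pebblingNumber_le_iff {V : Type} [Fintype V] [DecidableEq V] {E : V → V → Prop}
    {k : ℕ} : pebblingNumber E ≤ (k : ℕ∞) ↔ pebCond E k := by
  refine ⟨fun h => ?_, fun h => sInf_le ⟨k, rfl, h⟩⟩
  have hlt : pebblingNumber E < ((k + 1 : ℕ) : ℕ∞) :=
    h.trans_lt (Nat.cast_lt.2 k.lt_succ_self)
  obtain ⟨_, ⟨j, rfl, hj⟩, hjk⟩ := sInf_lt_iff.1 hlt
  exact pebCond_mono (Nat.lt_succ_iff.1 (Nat.cast_lt.1 hjk)) hj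

/-- A sequence of moves reaching a target uses fewer moves than there are pebbles. -/
theorem pebCond_iff_length_le {V : Type} [Fintype V] [DecidableEq V] {E : V → V → Prop}
    {k : ℕ} : pebCond E k ↔ ∀ (D : V → ℕ) (w : V), (∑ v, D v) = k →
      ∃ (ms : List (V × V)) (D' : V → ℕ),
        ms.length ≤ k - 1 ∧ moveSeqResult E D ms = some D' ∧ 1 ≤ D' w := by
  refine ⟨fun h D w hD => ?_, fun h D hD w => ?_⟩
  · obtain ⟨ms, D', hms, hw⟩ := h D hD w
    refine ⟨ms, D', ?_, hms, hw⟩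
    have h₁ := sum_moveSeqResult hms
    have h₂ := Finset.single_le_sum (fun v _ => Nat.zero_le (D' v)) (Finset.mem_univ w)
    omega
  · obtain ⟨ms, D', -, hms, hw⟩ := h D w hD
    exact ⟨ms, D', hms, hw⟩

/-- **Pebbling Number.** Let `G = ⟨V,E⟩` be a directed graph and
`k` an integer. Let `Π = ∀ˢᵗ P₁ ∃ˢᵗ P₂ : C` be the ASP(Q) program in which `P₁`
encodes `G` and guesses an arbitrary assignment of exactly `k` pebbles to the
nodes together with an arbitrary target node (its answer sets `encD D w`
correspond exactly to such pairs), `P₂` guesses a number `T ≤ k-1` of steps and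
a valid sequence of `T` pebbling moves starting from the guessed assignment
(the answer sets of `P₂ ∪ fix(encD D w)` correspond exactly to such sequences
with the resulting pebble counts), and `C` requires the target node to carry at
least one pebble after step `T`. Then `π(G) ≤ k` iff `Π` is coherent. -/
theorem pebbling_number_correct
    {V : Type} [Fintype V] [DecidableEq V] (E : V → V → Prop) (k : ℕ)
    (P1 P2 C : Program)
    (encD : (V → ℕ) → V → Interp)
    (encM : (V → ℕ) → V → List (V × V) → (V → ℕ) → Interp)
    (h1 : AS P1 = {M | ∃ (D : V → ℕ) (w : V), (∑ v, D v) = k ∧ M = encD D w})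
    (h2 : ∀ (D : V → ℕ) (w : V), (∑ v, D v) = k →
      AS (P2 ∪ fixProg P1 (encD D w)) =
        {M | ∃ (ms : List (V × V)) (D' : V → ℕ), ms.length ≤ k - 1 ∧
             moveSeqResult E D ms = some D' ∧ M = encM D w ms D'})
    (h3 : ∀ (D : V → ℕ) (w : V) (ms : List (V × V)) (D' : V → ℕ),
      (∑ v, D v) = k → ms.length ≤ k - 1 → moveSeqResult E D ms = some D' →
      (coherentP (C ∪ fixProg (P2 ∪ fixProg P1 (encD D w)) (encM D w ms D')) ↔
        1 ≤ D' w)) :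
    pebblingNumber E ≤ (k : ℕ∞) ↔
      QProg.coherent ⟨[(false, P1), (true, P2)], C⟩ := by
  rw [pebblingNumber_le_iff, pebCond_iff_length_le]
  simp only [QProg.coherent, cohFrom, Finset.union_empty, h1, Bool.false_eq_true, if_false,
    if_true]
  constructor
  · rintro h _ ⟨D, w, hD, rfl⟩
    obtain ⟨ms, D', hlen, hms, hw⟩ := h D w hD
    rw [h2 D w hD]
    exact ⟨_, ⟨ms, D', hlen, hms, rfl⟩, (h3 D w ms D' hD hlen hms).2 hw⟩
  · intro h D w hD
    obtain ⟨M, hM, hcoh⟩ := h _ ⟨D, w, hD, rfl⟩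
    rw [h2 D w hD] at hM
    obtain ⟨ms, D', hlen, hms, rfl⟩ := hM
    exact ⟨ms, D', hlen, hms, (h3 D w ms D' hD hlen hms).1 hcoh⟩

end ASPQ
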